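/- If {P_i} and {Q_j} are projective measurements on A such that {Q_j} refines {P_i} (each P_i is a sum of some of the Q_j), then the average entropy of Bob's conditional states does not increase under refinement: ∑_j q_j S(σ_j^B) ≤ ∑_i p_i S(ρ_i^B), where p_i, ρ_i^B (resp. q_j, σ_j^B) are the outcome probabilities and conditional Bob states for the measurement {P_i} (resp. {Q_j}) on a bipartite density matrix ρ_AB. -/

import Mathlib

open Matrix Kronecker
open scoped ComplexOrder

noncomputable section

/-- von Neumann entropy (natural logarithm): `S(ρ) = -∑ λ_k log λ_k`. -/
def vnEntropy {d : ℕ} (ρ : Matrix (Fin d) (Fin d) ℂ) : ℝ :=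
  if h : ρ.IsHermitian then -∑ k, h.eigenvalues k * Real.log (h.eigenvalues k) else 0

/-- von Neumann entropy in bits (log base 2). -/
def vnEntropy2 {d : ℕ} (ρ : Matrix (Fin d) (Fin d) ℂ) : ℝ :=
  if h : ρ.IsHermitian then -∑ k, h.eigenvalues k * Real.logb 2 (h.eigenvalues k) else 0

/-- A density matrix: positive semidefinite with unit trace. -/
def IsDensityMatrix {n : Type} [Fintype n] [DecidableEq n] (ρ : Matrix n n ℂ) : Prop :=
  ρ.PosSemidef ∧ ρ.trace = 1

/-- Partial trace over the B system. -/
def ptraceB {dA dB : ℕ} (ρ : Matrix (Fin dA × Fin dB) (Fin dA × Fin dB) ℂ) :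
    Matrix (Fin dA) (Fin dA) ℂ :=
  Matrix.of fun a a' => ∑ b, ρ (a, b) (a', b)

/-- Partial trace over the A system. -/
def ptraceA {dA dB : ℕ} (ρ : Matrix (Fin dA × Fin dB) (Fin dA × Fin dB) ℂ) :
    Matrix (Fin dB) (Fin dB) ℂ :=
  Matrix.of fun b b' => ∑ a, ρ (a, b) (a, b')

/-- A projective measurement on `ℂ^{dA}`: a finite family of mutually orthogonal
orthogonal projectors summing to the identity. -/
structure ProjMeas (dA m : ℕ) where
  P : Fin m → Matrix (Fin dA) (Fin dA) ℂ
  herm : ∀ i, (P i).IsHermitian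
  idem : ∀ i, P i * P i = P i
  orth : ∀ i j, i ≠ j → P i * P j = 0
  sum_eq : ∑ i, P i = 1

/-- A measurement is complete if all projectors are rank one. -/
def ProjMeas.Complete {dA m : ℕ} (M : ProjMeas dA m) : Prop :=
  ∀ i, (M.P i).rank = 1

/-- Outcome probability `p_i = Tr[(P_i ⊗ 1) ρ]`. -/
def prob {dA dB m : ℕ} (ρ : Matrix (Fin dA × Fin dB) (Fin dA × Fin dB) ℂ)
    (M : ProjMeas dA m) (i : Fin m) : ℝ :=
  (((M.P i ⊗ₖ (1 : Matrix (Fin dB) (Fin dB) ℂ)) * ρ).trace).re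

/-- Conditional state of Bob: `Tr_A[(P_i ⊗ 1) ρ (P_i ⊗ 1)] / p_i`. -/
def condB {dA dB m : ℕ} (ρ : Matrix (Fin dA × Fin dB) (Fin dA × Fin dB) ℂ)
    (M : ProjMeas dA m) (i : Fin m) : Matrix (Fin dB) (Fin dB) ℂ :=
  ((prob ρ M i : ℂ))⁻¹ •
    ptraceA ((M.P i ⊗ₖ (1 : Matrix (Fin dB) (Fin dB) ℂ)) * ρ *
      (M.P i ⊗ₖ (1 : Matrix (Fin dB) (Fin dB) ℂ)))

/-- `c_HV(ρ,{P_i}) = S(ρ_B) - ∑_i p_i S(ρ_i^B)`. -/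
def cHV {dA dB m : ℕ} (ρ : Matrix (Fin dA × Fin dB) (Fin dA × Fin dB) ℂ)
    (M : ProjMeas dA m) : ℝ :=
  vnEntropy (ptraceA ρ) - ∑ i, prob ρ M i * vnEntropy (condB ρ M i)

/-- Same, in bits. -/
def cHV2 {dA dB m : ℕ} (ρ : Matrix (Fin dA × Fin dB) (Fin dA × Fin dB) ℂ)
    (M : ProjMeas dA m) : ℝ :=
  vnEntropy2 (ptraceA ρ) - ∑ i, prob ρ M i * vnEntropy2 (condB ρ M i)

/-- Dephasing of a single-system state: `∑_i P_i σ P_i`. -/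
def deph {d m : ℕ} (σ : Matrix (Fin d) (Fin d) ℂ) (M : ProjMeas d m) :
    Matrix (Fin d) (Fin d) ℂ :=
  ∑ i, M.P i * σ * M.P i

/-- `δ_cl^→(ρ,{P_i}) = S(ρ_A) - S(ρ'_A) + c_HV(ρ,{P_i})`. -/
def deltaCl {dA dB m : ℕ} (ρ : Matrix (Fin dA × Fin dB) (Fin dA × Fin dB) ℂ)
    (M : ProjMeas dA m) : ℝ :=
  vnEntropy (ptraceB ρ) - vnEntropy (deph (ptraceB ρ) M) + cHV ρ M

/-- The Henderson–Vedral quantity: supremum of `c_HV` over complete projective measurements. -/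
def CHV {dA dB : ℕ} (ρ : Matrix (Fin dA × Fin dB) (Fin dA × Fin dB) ℂ) : ℝ :=
  sSup {x : ℝ | ∃ m, ∃ M : ProjMeas dA m, M.Complete ∧ x = cHV ρ M}

/-- One-way classical information deficit: supremum of `δ_cl^→` over complete
projective measurements. -/
def DeltaCl {dA dB : ℕ} (ρ : Matrix (Fin dA × Fin dB) (Fin dA × Fin dB) ℂ) : ℝ :=
  sSup {x : ℝ | ∃ m, ∃ M : ProjMeas dA m, M.Complete ∧ x = deltaCl ρ M}

/-- Alice-side dephasing of a bipartite state: `∑_i (P_i ⊗ 1) ρ (P_i ⊗ 1)`. -/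
def dephAB {dA dB m : ℕ} (ρ : Matrix (Fin dA × Fin dB) (Fin dA × Fin dB) ℂ)
    (M : ProjMeas dA m) : Matrix (Fin dA × Fin dB) (Fin dA × Fin dB) ℂ :=
  ∑ i, (M.P i ⊗ₖ (1 : Matrix (Fin dB) (Fin dB) ℂ)) * ρ *
    (M.P i ⊗ₖ (1 : Matrix (Fin dB) (Fin dB) ℂ))

/-- Outer product `|v⟩⟨v|`. -/
def outer {n : Type} [Fintype n] (v : n → ℂ) : Matrix n n ℂ :=
  Matrix.of fun x y => v x * star (v y)

/-- `Q` refines `P`: each projector of `P` is the sum of some of the projectors of `Q`. -/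
def Refines {dA m m' : ℕ} (Q : ProjMeas dA m') (P : ProjMeas dA m) : Prop :=
  ∃ f : Fin m' → Fin m, ∀ i, P.P i = ∑ j ∈ Finset.univ.filter (fun j => f j = i), Q.P j

/-- The diagonal of a Hermitian matrix in any orthonormal basis is the image of its spectrum under
a doubly stochastic matrix. -/
theorem Matrix.IsHermitian.exists_doublyStochastic_diag_conj {n : Type*} [Fintype n]
    [DecidableEq n] {A : Matrix n n ℂ} (hA : A.IsHermitian) (U : unitaryGroup n ℂ) :
    ∃ M ∈ doublyStochastic ℝ n, ∀ k,
      ((star (U : Matrix n n ℂ) * A * U) k k).re = ∑ l, M k l * hA.eigenvalues l := by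
  set W : unitaryGroup n ℂ := star hA.eigenvectorUnitary * U with hW
  have hconj : star (U : Matrix n n ℂ) * A * (U : Matrix n n ℂ) =
      star (W : Matrix n n ℂ) * diagonal (RCLike.ofReal ∘ hA.eigenvalues) * (W : Matrix n n ℂ) := by
    conv_lhs => rw [hA.spectral_theorem, Unitary.conjStarAlgAut_apply]
    simp [hW, mul_assoc]
  have hsq (z : ℂ) : star z * z = ((Complex.normSq z : ℝ) : ℂ) := by
    rw [Complex.normSq_eq_conj_mul_self]; rfl
  refine ⟨of fun k l => Complex.normSq ((W : Matrix n n ℂ) l k),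
    mem_doublyStochastic_iff_sum.2 ⟨fun k l => Complex.normSq_nonneg _, fun k => ?_, fun l => ?_⟩,
    fun k => ?_⟩
  · have h := congrFun (congrFun (Unitary.coe_star_mul_self W) k) k
    simp only [mul_apply, star_apply, one_apply_eq, hsq] at h
    exact_mod_cast h
  · have h := congrFun (congrFun (Unitary.coe_mul_star_self W) l) l
    simp only [Unitary.coe_star, mul_apply, star_apply, one_apply_eq, mul_comm _ (star _), hsq] at h
    exact_mod_cast h
  · have h : (star (U : Matrix n n ℂ) * A * U) k k =
        ((∑ l, Complex.normSq ((W : Matrix n n ℂ) l k) * hA.eigenvalues l : ℝ) : ℂ) := by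
      rw [hconj, mul_apply]
      push_cast
      refine Finset.sum_congr rfl fun l _ => ?_
      rw [mul_diagonal, star_apply, ← hsq]
      simp only [Function.comp_apply, RCLike.ofReal_eq_complex_ofReal]
      ring
    simp only [h, Complex.ofReal_re, of_apply]

theorem vnEntropy_eq_sum_negMulLog {d : ℕ} {σ : Matrix (Fin d) (Fin d) ℂ} (hσ : σ.IsHermitian) :
    vnEntropy σ = ∑ k, Real.negMulLog (hσ.eigenvalues k) := by
  simp [vnEntropy, hσ, Real.negMulLog]

/-- **Peierls inequality**: the entropy is at most that of the diagonal in any orthonormal basis. -/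
theorem vnEntropy_le_sum_negMulLog_diag {d : ℕ} {σ : Matrix (Fin d) (Fin d) ℂ}
    (hσ : σ.PosSemidef) (U : unitaryGroup (Fin d) ℂ) :
    vnEntropy σ ≤
      ∑ k, Real.negMulLog ((star (U : Matrix (Fin d) (Fin d) ℂ) * σ * U) k k).re := by
  obtain ⟨M, hM, hdiag⟩ := hσ.isHermitian.exists_doublyStochastic_diag_conj U
  obtain ⟨hnonneg, hrow, hcol⟩ := mem_doublyStochastic_iff_sum.1 hM
  calc vnEntropy σ
      = ∑ k, ∑ l, M k l * Real.negMulLog (hσ.isHermitian.eigenvalues l) := by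
        rw [vnEntropy_eq_sum_negMulLog hσ.isHermitian, Finset.sum_comm]
        simp [← Finset.sum_mul, hcol]
    _ ≤ _ := Finset.sum_le_sum fun k _ => by
        rw [hdiag]
        exact Real.concaveOn_negMulLog.le_map_sum (fun l _ => hnonneg k l) (hrow k)
          fun l _ => hσ.eigenvalues_nonneg l

/-- The von Neumann entropy is concave. -/
theorem sum_mul_vnEntropy_le {ι : Type*} {d : ℕ} (s : Finset ι) (w : ι → ℝ)
    (σ : ι → Matrix (Fin d) (Fin d) ℂ) (hw : ∀ j ∈ s, 0 ≤ w j) (hw1 : ∑ j ∈ s, w j = 1)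
    (hσ : ∀ j ∈ s, (σ j).PosSemidef) :
    ∑ j ∈ s, w j * vnEntropy (σ j) ≤ vnEntropy (∑ j ∈ s, (w j : ℂ) • σ j) := by
  have hρ : (∑ j ∈ s, (w j : ℂ) • σ j).IsHermitian :=
    (posSemidef_sum s fun j hj => (hσ j hj).smul (by exact_mod_cast hw j hj)).isHermitian
  set U := hρ.eigenvectorUnitary
  set D : ι → Fin d → ℝ := fun j k => ((star (U : Matrix (Fin d) (Fin d) ℂ) * σ j * U) k k).re
  have hD : ∀ k, hρ.eigenvalues k = ∑ j ∈ s, w j * D j k := fun k => by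
    have h := congrFun (congrFun hρ.conjStarAlgAut_star_eigenvectorUnitary k) k
    rw [Unitary.conjStarAlgAut_star_apply, Finset.mul_sum, Finset.sum_mul, Matrix.sum_apply,
      diagonal_apply_eq] at h
    have h' := congrArg Complex.re h
    simpa [D, U] using h'.symm
  calc ∑ j ∈ s, w j * vnEntropy (σ j)
      ≤ ∑ j ∈ s, w j * ∑ k, Real.negMulLog (D j k) := Finset.sum_le_sum fun j hj =>
        mul_le_mul_of_nonneg_left (vnEntropy_le_sum_negMulLog_diag (hσ j hj) U) (hw j hj)
    _ = ∑ k, ∑ j ∈ s, w j * Real.negMulLog (D j k) := by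
        simp_rw [Finset.mul_sum]
        exact Finset.sum_comm
    _ ≤ ∑ k, Real.negMulLog (hρ.eigenvalues k) := Finset.sum_le_sum fun k _ => by
        rw [hD]
        exact Real.concaveOn_negMulLog.le_map_sum hw hw1 fun j hj =>
          (Complex.nonneg_iff.1 ((hσ j hj).conjTranspose_mul_mul_same
            (U : Matrix (Fin d) (Fin d) ℂ)).diag_nonneg).1
    _ = _ := (vnEntropy_eq_sum_negMulLog hρ).symm

section PartialTrace

variable {dA dB m : ℕ}

theorem ptraceA_sum {ι : Type*} (s : Finset ι)
    (X : ι → Matrix (Fin dA × Fin dB) (Fin dA × Fin dB) ℂ) :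
    ptraceA (∑ j ∈ s, X j) = ∑ j ∈ s, ptraceA (X j) := by
  ext b b'
  simp only [ptraceA, of_apply, Matrix.sum_apply]
  exact Finset.sum_comm

theorem trace_ptraceA (X : Matrix (Fin dA × Fin dB) (Fin dA × Fin dB) ℂ) :
    (ptraceA X).trace = X.trace := by
  simp only [ptraceA, trace, diag_apply, of_apply, Fintype.sum_prod_type]
  exact Finset.sum_comm

theorem Matrix.PosSemidef.ptraceA {X : Matrix (Fin dA × Fin dB) (Fin dA × Fin dB) ℂ}
    (hX : X.PosSemidef) : (ptraceA X).PosSemidef := by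
  have h : _root_.ptraceA X = ∑ a, X.submatrix (Prod.mk a) (Prod.mk a) := by
    ext b b'
    simp [_root_.ptraceA, Matrix.sum_apply]
  rw [h]
  exact posSemidef_sum _ fun a _ => hX.submatrix _

theorem ptraceA_mul_kronecker_one (X : Matrix (Fin dA × Fin dB) (Fin dA × Fin dB) ℂ)
    (P : Matrix (Fin dA) (Fin dA) ℂ) :
    ptraceA (X * (P ⊗ₖ (1 : Matrix (Fin dB) (Fin dB) ℂ))) =
      ptraceA ((P ⊗ₖ (1 : Matrix (Fin dB) (Fin dB) ℂ)) * X) := by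
  ext b b'
  simp only [ptraceA, of_apply, mul_apply, kroneckerMap_apply, Fintype.sum_prod_type, one_apply,
    mul_ite, ite_mul, mul_one, mul_zero, zero_mul, Finset.sum_ite_eq, Finset.sum_ite_eq',
    Finset.mem_univ, if_true]
  rw [Finset.sum_comm]
  exact Finset.sum_congr rfl fun a _ => Finset.sum_congr rfl fun c _ => mul_comm _ _

/-- Bob's unnormalized conditional state after outcome `i`. -/
def unnormCondB (ρ : Matrix (Fin dA × Fin dB) (Fin dA × Fin dB) ℂ) (M : ProjMeas dA m)
    (i : Fin m) : Matrix (Fin dB) (Fin dB) ℂ :=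
  ptraceA ((M.P i ⊗ₖ (1 : Matrix (Fin dB) (Fin dB) ℂ)) * ρ *
    (M.P i ⊗ₖ (1 : Matrix (Fin dB) (Fin dB) ℂ)))

theorem unnormCondB_eq (ρ : Matrix (Fin dA × Fin dB) (Fin dA × Fin dB) ℂ) (M : ProjMeas dA m)
    (i : Fin m) : unnormCondB ρ M i =
      ptraceA ((M.P i ⊗ₖ (1 : Matrix (Fin dB) (Fin dB) ℂ)) * ρ) := by
  rw [unnormCondB, ptraceA_mul_kronecker_one, ← mul_assoc, ← mul_kronecker_mul, M.idem, one_mul]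

theorem condB_eq (ρ : Matrix (Fin dA × Fin dB) (Fin dA × Fin dB) ℂ) (M : ProjMeas dA m)
    (i : Fin m) : condB ρ M i = (prob ρ M i : ℂ)⁻¹ • unnormCondB ρ M i := rfl

variable {ρ : Matrix (Fin dA × Fin dB) (Fin dA × Fin dB) ℂ}

theorem posSemidef_unnormCondB (hρ : ρ.PosSemidef) (M : ProjMeas dA m) (i : Fin m) :
    (unnormCondB ρ M i).PosSemidef := by
  have h := hρ.mul_mul_conjTranspose_same (M.P i ⊗ₖ (1 : Matrix (Fin dB) (Fin dB) ℂ))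
  rw [conjTranspose_kronecker, (M.herm i).eq, conjTranspose_one] at h
  exact h.ptraceA

theorem trace_unnormCondB (hρ : ρ.PosSemidef) (M : ProjMeas dA m) (i : Fin m) :
    (unnormCondB ρ M i).trace = prob ρ M i := by
  have h := Complex.nonneg_iff.1 (posSemidef_unnormCondB hρ M i).trace_nonneg
  rw [unnormCondB_eq, trace_ptraceA] at h ⊢
  exact Complex.ext rfl (by simpa using h.2.symm)

theorem prob_nonneg (hρ : ρ.PosSemidef) (M : ProjMeas dA m) (i : Fin m) : 0 ≤ prob ρ M i := by
  have h := (posSemidef_unnormCondB hρ M i).trace_nonneg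
  rw [trace_unnormCondB hρ] at h
  exact_mod_cast h

theorem prob_smul_condB (hρ : ρ.PosSemidef) (M : ProjMeas dA m) (i : Fin m) :
    (prob ρ M i : ℂ) • condB ρ M i = unnormCondB ρ M i := by
  rw [condB_eq]
  by_cases h : prob ρ M i = 0
  · have h0 := (posSemidef_unnormCondB hρ M i).trace_eq_zero_iff.1
      (by simp [trace_unnormCondB hρ, h])
    simp [h0]
  · exact smul_inv_smul₀ (by exact_mod_cast h) _

theorem posSemidef_condB (hρ : ρ.PosSemidef) (M : ProjMeas dA m) (i : Fin m) :
    (condB ρ M i).PosSemidef := by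
  rw [condB_eq]
  refine (posSemidef_unnormCondB hρ M i).smul ?_
  rw [← Complex.ofReal_inv]
  exact_mod_cast inv_nonneg.2 (prob_nonneg hρ M i)

/-- Unnormalized conditional states add up under coarse graining. -/
theorem unnormCondB_eq_sum {m' : ℕ} {P : ProjMeas dA m} {Q : ProjMeas dA m'} {i : Fin m}
    {s : Finset (Fin m')} (h : P.P i = ∑ j ∈ s, Q.P j) :
    unnormCondB ρ P i = ∑ j ∈ s, unnormCondB ρ Q j := by
  have hk : (∑ j ∈ s, Q.P j) ⊗ₖ (1 : Matrix (Fin dB) (Fin dB) ℂ) =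
      ∑ j ∈ s, Q.P j ⊗ₖ (1 : Matrix (Fin dB) (Fin dB) ℂ) := by
    ext x y
    simp [Matrix.sum_apply, Finset.sum_mul]
  simp only [unnormCondB_eq]
  rw [h, hk, Finset.sum_mul, ptraceA_sum]

theorem prob_eq_sum {m' : ℕ} {P : ProjMeas dA m} {Q : ProjMeas dA m'} {i : Fin m}
    {s : Finset (Fin m')} (hρ : ρ.PosSemidef) (h : P.P i = ∑ j ∈ s, Q.P j) :
    prob ρ P i = ∑ j ∈ s, prob ρ Q j := by
  have ht := congrArg trace (unnormCondB_eq_sum (ρ := ρ) h)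
  simp only [trace_sum, trace_unnormCondB hρ] at ht
  exact_mod_cast ht

theorem sum_prob_mul_vnEntropy_condB_le {m' : ℕ} {P : ProjMeas dA m} {Q : ProjMeas dA m'}
    {i : Fin m} {s : Finset (Fin m')} (hρ : ρ.PosSemidef) (h : P.P i = ∑ j ∈ s, Q.P j) :
    ∑ j ∈ s, prob ρ Q j * vnEntropy (condB ρ Q j) ≤ prob ρ P i * vnEntropy (condB ρ P i) := by
  have hp := prob_eq_sum hρ h
  by_cases h0 : prob ρ P i = 0
  · have hq := (Finset.sum_eq_zero_iff_of_nonneg fun j _ => prob_nonneg hρ Q j).1 (hp ▸ h0)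
    rw [h0, zero_mul, Finset.sum_eq_zero fun j hj => by rw [hq j hj, zero_mul]]
  · have hmix : condB ρ P i =
        ∑ j ∈ s, ((prob ρ Q j / prob ρ P i : ℝ) : ℂ) • condB ρ Q j := by
      rw [condB_eq, unnormCondB_eq_sum h, Finset.smul_sum]
      refine Finset.sum_congr rfl fun j _ => ?_
      rw [← prob_smul_condB hρ, smul_smul, Complex.ofReal_div, div_eq_inv_mul]
    have hconc := sum_mul_vnEntropy_le s (fun j => prob ρ Q j / prob ρ P i) (condB ρ Q)
      (fun j _ => div_nonneg (prob_nonneg hρ Q j) (prob_nonneg hρ P i))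
      (by rw [← Finset.sum_div, ← hp, div_self h0]) fun j _ => posSemidef_condB hρ Q j
    rw [← hmix] at hconc
    refine le_trans (le_of_eq ?_) (mul_le_mul_of_nonneg_left hconc (prob_nonneg hρ P i))
    rw [Finset.mul_sum]
    refine Finset.sum_congr rfl fun j _ => ?_
    field_simp

end PartialTrace

/-- refining a projective measurement does not increase the average
entropy of Bob's conditional states. -/
theorem avg_entropy_refine_le {dA dB m m' : ℕ}
    (ρ : Matrix (Fin dA × Fin dB) (Fin dA × Fin dB) ℂ) (hρ : IsDensityMatrix ρ)
    (P : ProjMeas dA m) (Q : ProjMeas dA m') (hQP : Refines Q P) :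
    ∑ j, prob ρ Q j * vnEntropy (condB ρ Q j) ≤
      ∑ i, prob ρ P i * vnEntropy (condB ρ P i) := by
  obtain ⟨f, hf⟩ := hQP
  rw [← Finset.sum_fiberwise Finset.univ f]
  exact Finset.sum_le_sum fun i _ => sum_prob_mul_vnEntropy_condB_le hρ.1 (hf i)

end
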